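/- arXiv:1502.05204 — 2 statements merged into one kernel-verified Lean document; each statement's English description precedes it below -/
import Mathlib

section
/- Let A and B be finite subsets of an abelian group, let G ⊆ A×B, let N ≥ 1, t > 0, and 0 < α ≤ 1. Suppose |A||B| ≤ N², |{a+b : (a,b) ∈ G}| ≤ tN, and |G| ≥ αN². Then there exist subsets A' ⊆ A and B' ⊆ B such that (i) |A'+B'| ≤ 2¹⁷·(1/α)⁵·t³·N, and (ii) |G ∩ (A'×B')| ≥ α|A'||B|/4 ≥ α²N²/32. -/
open Finset Pointwise

/-- Discarding the vertices of degree less than `d / 2` keeps at least half of the edges. -/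
theorem sum_degree_popular_ge {V W : Type*} (r : V → W → Prop) [∀ a b, Decidable (r a b)]
    (A : Finset V) (B : Finset W) (d : ℝ) (hd : 0 ≤ d)
    (h : d * #A ≤ ∑ a ∈ A, (#{b ∈ B | r a b} : ℝ)) :
    d / 2 * #A ≤ ∑ a ∈ A with d / 2 ≤ (#{b ∈ B | r a b} : ℝ), (#{b ∈ B | r a b} : ℝ) := by
  have hsplit := Finset.sum_filter_add_sum_filter_not A
    (fun a => d / 2 ≤ (#{b ∈ B | r a b} : ℝ)) (fun a => (#{b ∈ B | r a b} : ℝ))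
  have hsmall : ∑ a ∈ A with ¬ d / 2 ≤ (#{b ∈ B | r a b} : ℝ), (#{b ∈ B | r a b} : ℝ)
      ≤ d / 2 * #A := by
    calc _ ≤ #{a ∈ A | ¬ d / 2 ≤ (#{b ∈ B | r a b} : ℝ)} • (d / 2) :=
          Finset.sum_le_card_nsmul _ _ _ fun a ha => (not_le.1 (mem_filter.1 ha).2).le
      _ ≤ d / 2 * #A := by
          rw [nsmul_eq_mul, mul_comm]
          gcongr
          exact filter_subset _ _
  linarith

/-- Dependent random choice: some neighbourhood `{a ∈ U | r a b}` is large and contains few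
pairs with fewer than `c` common neighbours. -/
theorem exists_neighborhood_few_bad_pairs {V W : Type*} (r : V → W → Prop)
    [∀ a b, Decidable (r a b)] (U : Finset V) (B : Finset W) (hB : B.Nonempty)
    (x η c : ℝ) (hx : 0 ≤ x) (hη : 0 ≤ η) (hc : 0 ≤ c)
    (h : x * #B ≤ ∑ a ∈ U, (#{b ∈ B | r a b} : ℝ)) :
    ∃ b ∈ B, (η * x ^ 2 - c * #U ^ 2 / #B) +
      #{p ∈ U ×ˢ U | (#{b' ∈ B | r p.1 b' ∧ r p.2 b'} : ℝ) < c ∧ (r p.1 b ∧ r p.2 b)}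
        ≤ η * (#{a ∈ U | r a b} : ℝ) ^ 2 := by
  have hB0 : (0 : ℝ) < #B := by exact_mod_cast hB.card_pos
  apply Finset.exists_le_of_sum_le hB
  rw [Finset.sum_add_distrib, Finset.sum_const, nsmul_eq_mul, ← Finset.mul_sum]
  have hdeg : (∑ a ∈ U, (#{b ∈ B | r a b} : ℝ)) = ∑ b ∈ B, (#{a ∈ U | r a b} : ℝ) := by
    exact_mod_cast Finset.sum_card_bipartiteAbove_eq_sum_card_bipartiteBelow r
  have hsq : x ^ 2 * #B ≤ ∑ b ∈ B, (#{a ∈ U | r a b} : ℝ) ^ 2 := by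
    have hcs := sq_sum_le_card_mul_sum_sq (s := B) (f := fun b => (#{a ∈ U | r a b} : ℝ))
    rw [← hdeg] at hcs
    have hsq' : (x * #B) ^ 2 ≤ (∑ a ∈ U, (#{b ∈ B | r a b} : ℝ)) ^ 2 := by gcongr
    have : (#B : ℝ) * (x ^ 2 * #B) ≤ #B * ∑ b ∈ B, (#{a ∈ U | r a b} : ℝ) ^ 2 := by
      calc _ = (x * #B) ^ 2 := by ring
        _ ≤ _ := hsq'.trans hcs
    exact le_of_mul_le_mul_left this hB0
  have hbad : ∑ b ∈ B,
      (#{p ∈ U ×ˢ U | (#{b' ∈ B | r p.1 b' ∧ r p.2 b'} : ℝ) < c ∧ (r p.1 b ∧ r p.2 b)} : ℝ)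
        ≤ c * #U ^ 2 := by
    set P := {p ∈ U ×ˢ U | (#{b' ∈ B | r p.1 b' ∧ r p.2 b'} : ℝ) < c} with hP
    have hcount : ∑ p ∈ P, (#{b ∈ B | r p.1 b ∧ r p.2 b} : ℝ) =
        ∑ b ∈ B, (#{p ∈ P | r p.1 b ∧ r p.2 b} : ℝ) := by
      exact_mod_cast Finset.sum_card_bipartiteAbove_eq_sum_card_bipartiteBelow
        (fun (p : V × V) b => r p.1 b ∧ r p.2 b)
    have hfilter : ∀ b, {p ∈ U ×ˢ U | (#{b' ∈ B | r p.1 b' ∧ r p.2 b'} : ℝ) < c ∧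
        (r p.1 b ∧ r p.2 b)} = {p ∈ P | r p.1 b ∧ r p.2 b} := fun b => by
      rw [hP, Finset.filter_filter]
    simp only [hfilter]
    rw [← hcount]
    calc _ ≤ #P • c := Finset.sum_le_card_nsmul _ _ _ fun p hp => (mem_filter.1 hp).2.le
      _ ≤ #(U ×ˢ U) • c := by
          gcongr
          exact filter_subset _ _
      _ = c * #U ^ 2 := by
          rw [nsmul_eq_mul, card_product]
          push_cast
          ring
  have hmain := mul_le_mul_of_nonneg_left hsq hη
  have hexp : (#B : ℝ) * (η * x ^ 2 - c * #U ^ 2 / #B) = η * (x ^ 2 * #B) - c * #U ^ 2 := by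
    field_simp
  rw [hexp]
  linarith

/-- If a set `X` carries at most `η |X|²` bad ordered pairs, then at least half of its elements
lie in at most `2 η |X|` bad pairs. -/
theorem half_card_le_card_few_bad {V : Type*} (bad : V → V → Prop)
    [∀ a b, Decidable (bad a b)] (X : Finset V) (η : ℝ) (hη : 0 < η)
    (h : (#{p ∈ X ×ˢ X | bad p.1 p.2} : ℝ) ≤ η * #X ^ 2) :
    (#X : ℝ) / 2 ≤ #{a ∈ X | (#{a' ∈ X | bad a a'} : ℝ) ≤ 2 * η * #X} := by
  rcases X.eq_empty_or_nonempty with rfl | hX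
  · simp
  have hX0 : (0 : ℝ) < #X := by exact_mod_cast hX.card_pos
  have hsplit := Finset.card_filter_add_card_filter_not (s := X)
    (fun a => (#{a' ∈ X | bad a a'} : ℝ) ≤ 2 * η * #X)
  have hsplit' : (#{a ∈ X | (#{a' ∈ X | bad a a'} : ℝ) ≤ 2 * η * #X} : ℝ) +
      #{a ∈ X | ¬ (#{a' ∈ X | bad a a'} : ℝ) ≤ 2 * η * #X} = #X := by exact_mod_cast hsplit
  have hsum : (#{p ∈ X ×ˢ X | bad p.1 p.2} : ℝ) = ∑ a ∈ X, (#{a' ∈ X | bad a a'} : ℝ) := by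
    simp only [Finset.card_filter, Finset.sum_product, Nat.cast_sum]
  have hmany : (#{a ∈ X | ¬ (#{a' ∈ X | bad a a'} : ℝ) ≤ 2 * η * #X} : ℝ) * (2 * η * #X)
      ≤ η * #X ^ 2 := by
    rw [← nsmul_eq_mul]
    calc _ ≤ ∑ a ∈ X with ¬ (#{a' ∈ X | bad a a'} : ℝ) ≤ 2 * η * #X,
          (#{a' ∈ X | bad a a'} : ℝ) :=
          Finset.card_nsmul_le_sum _ _ _ fun a ha => (not_le.1 (mem_filter.1 ha).2).le
      _ ≤ ∑ a ∈ X, (#{a' ∈ X | bad a a'} : ℝ) :=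
          Finset.sum_le_sum_of_subset_of_nonneg (filter_subset _ _) fun _ _ _ => by positivity
      _ ≤ _ := hsum ▸ h
  have hhalf : (#{a ∈ X | ¬ (#{a' ∈ X | bad a a'} : ℝ) ≤ 2 * η * #X} : ℝ) ≤ #X / 2 := by
    have hpos : 0 < 2 * η * #X := by positivity
    refine le_of_mul_le_mul_right (hmany.trans_eq ?_) hpos
    ring
  linarith

/-- Lower bound for the number of paths of length three from `a` to `b`, when `b` has many
neighbours in `A'` of which few have a small common neighbourhood with `a`. -/
theorem mul_le_card_paths {V W : Type*} (r : V → W → Prop) [∀ a b, Decidable (r a b)]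
    (A A' : Finset V) (B : Finset W) (hA' : A' ⊆ A) (c m k : ℝ) (hc : 0 ≤ c) (a : V) (b : W)
    (hb : m + k ≤ #{a' ∈ A' | r a' b})
    (ha : (#{a' ∈ A' | (#{b' ∈ B | r a b' ∧ r a' b'} : ℝ) < c} : ℝ) ≤ k) :
    m * c ≤ #{p ∈ A ×ˢ B | r a p.2 ∧ r p.1 p.2 ∧ r p.1 b} := by
  have hsplit := Finset.card_filter_add_card_filter_not (s := {a' ∈ A' | r a' b})
    (fun a' => (#{b' ∈ B | r a b' ∧ r a' b'} : ℝ) < c)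
  set Q := {a' ∈ {a' ∈ A' | r a' b} | ¬ (#{b' ∈ B | r a b' ∧ r a' b'} : ℝ) < c} with hQ
  have hle : #{a' ∈ {a' ∈ A' | r a' b} | (#{b' ∈ B | r a b' ∧ r a' b'} : ℝ) < c} ≤
      #{a' ∈ A' | (#{b' ∈ B | r a b' ∧ r a' b'} : ℝ) < c} :=
    card_le_card (filter_subset_filter _ (filter_subset _ _))
  have hQm : m ≤ #Q := by
    have h₁ : (#{a' ∈ {a' ∈ A' | r a' b} | (#{b' ∈ B | r a b' ∧ r a' b'} : ℝ) < c} : ℝ) + #Q =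
      #{a' ∈ A' | r a' b} := by exact_mod_cast hsplit
    have h₂ := (Nat.cast_le (α := ℝ)).2 hle
    linarith
  have hQA : Q ⊆ A := (filter_subset _ _).trans ((filter_subset _ _).trans hA')
  calc m * c ≤ #Q • c := by
        rw [nsmul_eq_mul]
        gcongr
    _ ≤ ∑ a' ∈ Q, (#{b' ∈ B | r a b' ∧ r a' b'} : ℝ) :=
        Finset.card_nsmul_le_sum _ _ _ fun a' ha' => not_lt.1 (mem_filter.1 ha').2
    _ = ∑ a' ∈ Q, (#{b' ∈ B | r a b' ∧ r a' b' ∧ r a' b} : ℝ) := by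
        refine Finset.sum_congr rfl fun a' ha' => ?_
        have : r a' b := (mem_filter.1 (mem_filter.1 ha').1).2
        simp [this]
    _ ≤ ∑ a' ∈ A, (#{b' ∈ B | r a b' ∧ r a' b' ∧ r a' b} : ℝ) :=
        Finset.sum_le_sum_of_subset_of_nonneg hQA fun _ _ _ => by positivity
    _ = _ := by
        simp only [Finset.card_filter, Finset.sum_product, Nat.cast_sum]

/-- If every vertex of `A'` has at least `δ |B|` neighbours in `B`, then deleting from `B` the
vertices with fewer than `δ |A'| / 2` neighbours in `A'` leaves at least `δ |A'| |B| / 2` edges. -/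
theorem card_edges_popular_ge {V W : Type*} (r : V → W → Prop) [∀ a b, Decidable (r a b)]
    (A' : Finset V) (B : Finset W) (δ : ℝ) (hδ : 0 ≤ δ)
    (h : ∀ a ∈ A', δ * #B ≤ #{b ∈ B | r a b}) :
    δ / 2 * #A' * #B ≤
      #{p ∈ A' ×ˢ {b ∈ B | δ * #A' / 2 ≤ (#{a ∈ A' | r a b} : ℝ)} | r p.1 p.2} := by
  have hdeg : (∑ a ∈ A', (#{b ∈ B | r a b} : ℝ)) = ∑ b ∈ B, (#{a ∈ A' | r a b} : ℝ) := by
    exact_mod_cast Finset.sum_card_bipartiteAbove_eq_sum_card_bipartiteBelow r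
  have hsum : #A' • (δ * #B) ≤ ∑ a ∈ A', (#{b ∈ B | r a b} : ℝ) :=
    Finset.card_nsmul_le_sum _ _ _ h
  have := sum_degree_popular_ge (fun b a => r a b) B A' (δ * #A') (by positivity) (by
    rw [← hdeg]
    refine le_trans (le_of_eq ?_) hsum
    rw [nsmul_eq_mul]
    ring)
  calc _ = δ * #A' / 2 * #B := by ring
    _ ≤ _ := this
    _ = _ := by simp only [Finset.card_filter, Finset.sum_product_right, Nat.cast_sum]

/-- A bipartite graph of density `δ` contains a dense bipartite subgraph with any two vertices on
opposite sides joined by at least `δ⁵ |A| |B| / 2¹⁴` paths of length three. -/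
theorem exists_subgraph_many_paths {V W : Type*} (r : V → W → Prop) [∀ a b, Decidable (r a b)]
    (A : Finset V) (B : Finset W) (hA : A.Nonempty) (hB : B.Nonempty) (δ : ℝ) (hδ : 0 < δ)
    (h : δ * #A * #B ≤ #{p ∈ A ×ˢ B | r p.1 p.2}) :
    ∃ A' ⊆ A, ∃ B' ⊆ B, δ * #A / 8 ≤ #A' ∧
      δ * #A' * #B / 4 ≤ #{p ∈ A' ×ˢ B' | r p.1 p.2} ∧
      ∀ a ∈ A', ∀ b ∈ B',
        δ ^ 5 / 2 ^ 14 * #A * #B ≤ #{p ∈ A ×ˢ B | r a p.2 ∧ r p.1 p.2 ∧ r p.1 b} := by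
  have hA0 : (0 : ℝ) < #A := by exact_mod_cast hA.card_pos
  have hB0 : (0 : ℝ) < #B := by exact_mod_cast hB.card_pos
  have hsum : (#{p ∈ A ×ˢ B | r p.1 p.2} : ℝ) = ∑ a ∈ A, (#{b ∈ B | r a b} : ℝ) := by
    simp only [Finset.card_filter, Finset.sum_product, Nat.cast_sum]
  have hpop := sum_degree_popular_ge r A B (δ * #B) (by positivity) (by
    rw [← hsum]
    linarith)
  set U := {a ∈ A | δ * #B / 2 ≤ (#{b ∈ B | r a b} : ℝ)} with hU
  have hUA : (#U : ℝ) ≤ #A := by exact_mod_cast card_le_card (filter_subset _ _)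
  set c := δ ^ 3 / 256 * #B with hc
  obtain ⟨b₀, -, hb₀⟩ := exists_neighborhood_few_bad_pairs r U B hB (δ * #A / 2) (δ / 32) c
    (by positivity) (by positivity) (by positivity) (by linarith)
  set X := {a ∈ U | r a b₀} with hX
  have hbadX : {p ∈ U ×ˢ U | (#{b' ∈ B | r p.1 b' ∧ r p.2 b'} : ℝ) < c ∧ (r p.1 b₀ ∧ r p.2 b₀)} =
      {p ∈ X ×ˢ X | (#{b' ∈ B | r p.1 b' ∧ r p.2 b'} : ℝ) < c} := by
    ext p
    simp only [hX, mem_filter, mem_product]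
    tauto
  rw [hbadX] at hb₀
  have hgain : δ / 32 * (δ ^ 2 * #A ^ 2 / 8) ≤
      δ / 32 * (δ * #A / 2) ^ 2 - c * #U ^ 2 / #B := by
    have hcU : c * #U ^ 2 / #B ≤ δ ^ 3 / 256 * #A ^ 2 := by
      calc c * #U ^ 2 / #B = δ ^ 3 / 256 * #U ^ 2 := by
            rw [hc]
            field_simp
        _ ≤ _ := by gcongr
    linarith
  have hfew : (#{p ∈ X ×ˢ X | (#{b' ∈ B | r p.1 b' ∧ r p.2 b'} : ℝ) < c} : ℝ) ≤
      δ / 32 * #X ^ 2 := by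
    have : 0 ≤ δ / 32 * (δ ^ 2 * #A ^ 2 / 8) := by positivity
    linarith
  have hXlarge : δ * #A / 4 ≤ #X := by
    have hsq : δ ^ 2 * #A ^ 2 / 8 ≤ (#X : ℝ) ^ 2 := by
      refine le_of_mul_le_mul_left (a := δ / 32) ?_ (by positivity)
      have : (0 : ℝ) ≤ #{p ∈ X ×ˢ X | (#{b' ∈ B | r p.1 b' ∧ r p.2 b'} : ℝ) < c} := by positivity
      linarith
    refine le_of_sq_le_sq ?_ (by positivity)
    have : 0 ≤ δ ^ 2 * (#A : ℝ) ^ 2 := by positivity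
    linarith [show (δ * #A / 4) ^ 2 = δ ^ 2 * (#A : ℝ) ^ 2 / 16 by ring]
  have hhalf := half_card_le_card_few_bad
    (fun a a' => (#{b' ∈ B | r a b' ∧ r a' b'} : ℝ) < c) X (δ / 32) (by positivity) hfew
  set A' := {a ∈ X | (#{a' ∈ X | (#{b' ∈ B | r a b' ∧ r a' b'} : ℝ) < c} : ℝ) ≤
    2 * (δ / 32) * #X} with hA'
  have hA'U : A' ⊆ U := (filter_subset _ _).trans (filter_subset _ _)
  have hA'A : A' ⊆ A := hA'U.trans (filter_subset _ _)
  refine ⟨A', hA'A, {b ∈ B | δ / 2 * #A' / 2 ≤ (#{a ∈ A' | r a b} : ℝ)}, filter_subset _ _,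
    by linarith, ?_, ?_⟩
  · have := card_edges_popular_ge r A' B (δ / 2) (by positivity) fun a ha => by
      have := (mem_filter.1 (hA'U ha)).2
      linarith
    linarith
  · intro a ha b hb
    have hbdeg := (mem_filter.1 hb).2
    have habad := (mem_filter.1 ha).2
    have hsub : (#{a' ∈ A' | (#{b' ∈ B | r a b' ∧ r a' b'} : ℝ) < c} : ℝ) ≤
        #{a' ∈ X | (#{b' ∈ B | r a b' ∧ r a' b'} : ℝ) < c} := by
      exact_mod_cast card_le_card (filter_subset_filter _ (filter_subset _ _))
    have hδX : δ * #X ≤ δ * (2 * #A') := by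
      gcongr
      linarith
    have hpaths := mul_le_card_paths r A A' B hA'A c (δ * #A' / 8) (δ * #A' / 8) (by positivity)
      a b (by linarith) (by linarith)
    refine le_trans ?_ hpaths
    calc δ ^ 5 / 2 ^ 14 * #A * #B = δ * (δ * #A / 8) / 8 * c := by
          rw [hc]
          ring
      _ ≤ δ * #A' / 8 * c := by
          gcongr
          linarith

/-- Each sum `a + b` with many paths `a, b', a', b` in `G` has many representations
`(a + b') - (a' + b') + (a' + b)` by sums along edges of `G`. -/
theorem card_add_mul_le_card_image_pow {γ : Type*} [AddCommGroup γ] [DecidableEq γ]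
    (A B A' B' : Finset γ) (G : Finset (γ × γ)) (k : ℝ)
    (h : ∀ a ∈ A', ∀ b ∈ B',
      k ≤ #{p ∈ A ×ˢ B | (a, p.2) ∈ G ∧ (p.1, p.2) ∈ G ∧ (p.1, b) ∈ G}) :
    #(A' + B') * k ≤ (#(G.image fun p => p.1 + p.2) : ℝ) ^ 3 := by
  set S := G.image fun p => p.1 + p.2 with hS
  have hmem : ∀ {x y}, (x, y) ∈ G → x + y ∈ S := fun hxy =>
    mem_image_of_mem (fun p : γ × γ => p.1 + p.2) hxy
  have hfib : ∀ s ∈ A' + B', k ≤ #{q ∈ S ×ˢ S ×ˢ S | q.1 - q.2.1 + q.2.2 = s} := by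
    intro s hs
    obtain ⟨a, ha, b, hb, rfl⟩ := mem_add.1 hs
    refine (h a ha b hb).trans ?_
    norm_cast
    refine card_le_card_of_injOn (fun p => (a + p.2, p.1 + p.2, p.1 + b)) ?_ ?_
    · intro p hp
      obtain ⟨-, h₁, h₂, h₃⟩ := mem_filter.1 hp
      refine mem_filter.2 ⟨mem_product.2 ⟨hmem h₁, mem_product.2 ⟨hmem h₂, hmem h₃⟩⟩, ?_⟩
      dsimp only
      abel
    · rintro ⟨x, y⟩ - ⟨x', y'⟩ - heq
      simp only [Prod.mk.injEq, add_right_inj, add_left_inj] at heq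
      exact Prod.ext heq.2.2 heq.1
  calc _ = #(A' + B') • k := (nsmul_eq_mul _ _).symm
    _ ≤ ∑ s ∈ A' + B', (#{q ∈ S ×ˢ S ×ˢ S | q.1 - q.2.1 + q.2.2 = s} : ℝ) :=
        Finset.card_nsmul_le_sum _ _ _ hfib
    _ ≤ #(S ×ˢ S ×ˢ S) := by
        rw [← Nat.cast_sum, Nat.cast_le, Finset.sum_card_fiberwise_eq_card_filter]
        exact card_le_card (filter_subset _ _)
    _ = _ := by
        simp only [card_product, Nat.cast_mul]
        ring

/-- **Balog–Szemerédi–Gowers Theorem** (version with an arbitrary subgraph `G` of `A × B`).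
If `|A||B| ≤ N²`, `|{a+b : (a,b) ∈ G}| ≤ tN` and `|G| ≥ αN²`, then there are subsets
`A' ⊆ A`, `B' ⊆ B` with `|A'+B'| ≤ 2¹⁷(1/α)⁵t³N` and
`|G ∩ (A'×B')| ≥ α|A'||B|/4 ≥ α²N²/32`. -/
theorem stmt_1 {γ : Type*} [AddCommGroup γ] [DecidableEq γ]
    (A B : Finset γ) (G : Finset (γ × γ)) (hG : G ⊆ A ×ˢ B)
    (N t α : ℝ) (hN : 1 ≤ N) (ht : 0 < t) (hα0 : 0 < α) (hα1 : α ≤ 1)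
    (hAB : (A.card : ℝ) * (B.card : ℝ) ≤ N ^ 2)
    (hS : (((G.image fun p => p.1 + p.2)).card : ℝ) ≤ t * N)
    (hGcard : α * N ^ 2 ≤ (G.card : ℝ)) :
    ∃ A' ⊆ A, ∃ B' ⊆ B,
      (((A' + B').card : ℝ) ≤ 2 ^ 17 * (1 / α) ^ 5 * t ^ 3 * N) ∧
      α * (A'.card : ℝ) * (B.card : ℝ) / 4 ≤ ((G ∩ (A' ×ˢ B')).card : ℝ) ∧
      α ^ 2 * N ^ 2 / 32 ≤ α * (A'.card : ℝ) * (B.card : ℝ) / 4 := by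
  have hG0 : (0 : ℝ) < #G := lt_of_lt_of_le (by positivity) hGcard
  obtain ⟨p₀, hp₀⟩ : G.Nonempty := card_pos.1 (by exact_mod_cast hG0)
  have hA : A.Nonempty := ⟨_, (mem_product.1 (hG hp₀)).1⟩
  have hB : B.Nonempty := ⟨_, (mem_product.1 (hG hp₀)).2⟩
  have hA0 : (0 : ℝ) < #A := by exact_mod_cast hA.card_pos
  have hB0 : (0 : ℝ) < #B := by exact_mod_cast hB.card_pos
  obtain ⟨δ, hδ⟩ : ∃ δ : ℝ, δ = #G / (#A * #B) := ⟨_, rfl⟩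
  have hδG : δ * #A * #B = #G := by
    rw [hδ]
    field_simp
  have hδ0 : 0 < δ := by
    rw [hδ]
    positivity
  have hαδ : α ≤ δ := by
    rw [hδ, le_div_iff₀ (by positivity)]
    exact (mul_le_mul_of_nonneg_left hAB hα0.le).trans hGcard
  have hfilter : {p ∈ A ×ˢ B | (p.1, p.2) ∈ G} = G := by
    rw [Finset.filter_mem_eq_inter, inter_eq_right.2 hG]
  obtain ⟨A', hA', B', hB', hcard, hedges, hpaths⟩ :=
    exists_subgraph_many_paths (fun a b => (a, b) ∈ G) A B hA hB δ hδ0 (by rw [hfilter, hδG])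
  have hinter : {p ∈ A' ×ˢ B' | (p.1, p.2) ∈ G} = G ∩ A' ×ˢ B' := by
    rw [Finset.filter_mem_eq_inter, inter_comm]
  rw [hinter] at hedges
  refine ⟨A', hA', B', hB', ?_, le_trans (by gcongr) hedges, ?_⟩
  · have hcount := card_add_mul_le_card_image_pow A B A' B' G _ hpaths
    have hk : α ^ 5 * N ^ 2 / 2 ^ 14 ≤ δ ^ 5 / 2 ^ 14 * #A * #B := by
      calc α ^ 5 * N ^ 2 / 2 ^ 14 = α ^ 4 * (α * N ^ 2) / 2 ^ 14 := by ring
        _ ≤ δ ^ 4 * #G / 2 ^ 14 := by gcongr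
        _ = _ := by
            rw [← hδG]
            ring
    have hN0 : 0 < N := by linarith
    have hbound : (#(A' + B') : ℝ) * (α ^ 5 * N ^ 2 / 2 ^ 14) ≤ (t * N) ^ 3 :=
      (mul_le_mul_of_nonneg_left hk (by positivity)).trans (hcount.trans (by gcongr))
    rw [← le_div_iff₀ (by positivity)] at hbound
    calc (#(A' + B') : ℝ) ≤ (t * N) ^ 3 / (α ^ 5 * N ^ 2 / 2 ^ 14) := hbound
      _ = 2 ^ 14 * (1 / α) ^ 5 * t ^ 3 * N := by
          field_simp
      _ ≤ 2 ^ 17 * (1 / α) ^ 5 * t ^ 3 * N := by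
          gcongr <;> norm_num
  · calc α ^ 2 * N ^ 2 / 32 = α * (α * N ^ 2) / 32 := by ring
      _ ≤ α * #G / 32 := by gcongr
      _ = α * (δ * #A / 8) * #B / 4 := by
          rw [← hδG]
          ring
      _ ≤ _ := by gcongr
end

section
/- There is an absolute constant c > 0 with the following property. For every integer U ≥ 2 and every finite set T ⊆ {0, 1, …, U−1} with |T| = N ≥ 2, there exist an integer k ≤ log₂ N + 1 and primes p₁, …, p_k, each at most c·N·(log₂ U)², such that for every x ∈ T there is an index i ∈ {1, …, k} with: no y ∈ T with y ≠ x satisfies y ≡ x (mod p_i). -/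
/-- A nonzero natural number `n` has at most `log₂ n` distinct prime factors. -/
theorem card_primeFactors_le_log {n : ℕ} (hn : n ≠ 0) : n.primeFactors.card ≤ Nat.log 2 n := by
  refine Nat.le_log_of_pow_le one_lt_two ?_
  calc 2 ^ n.primeFactors.card ≤ ∏ p ∈ n.primeFactors, p :=
        Finset.pow_card_le_prod _ _ _ fun p hp => (Nat.prime_of_mem_primeFactors hp).two_le
    _ ≤ n := Nat.le_of_dvd (Nat.pos_of_ne_zero hn) (Nat.prod_primeFactors_dvd n)

/-- Two distinct numbers below `U` collide modulo at most `log₂ U` primes. -/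
theorem card_filter_mod_eq_le_log {P : Finset ℕ} (hP : ∀ p ∈ P, p.Prime) {U x y : ℕ}
    (hx : x < U) (hy : y < U) (hyx : y ≠ x) :
    (P.filter fun p => y % p = x % p).card ≤ Nat.log 2 U := by
  wlog h : x ≤ y generalizing x y
  · simpa only [eq_comm] using this hy hx hyx.symm (by omega)
  have hsub : (P.filter fun p => y % p = x % p) ⊆ (y - x).primeFactors := fun p hp => by
    obtain ⟨hpP, hp⟩ := Finset.mem_filter.1 hp
    exact Nat.mem_primeFactors.2
      ⟨hP p hpP, (Nat.modEq_iff_dvd' h).1 (Eq.symm hp), by omega⟩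
  calc _ ≤ (y - x).primeFactors.card := Finset.card_le_card hsub
    _ ≤ Nat.log 2 (y - x) := card_primeFactors_le_log (by omega)
    _ ≤ Nat.log 2 U := Nat.log_mono_right (by omega)

/-- If every point of `S` is bad for at most half of the elements of `P`, then some element of `P`
is bad for at most half of the points of `S`. -/
theorem exists_two_mul_card_filter_le {α β : Type*} {P : Finset β} (hP : P.Nonempty)
    (S : Finset α) (bad : α → β → Prop) [∀ x p, Decidable (bad x p)]
    (h : ∀ x ∈ S, 2 * (P.filter fun p => bad x p).card ≤ P.card) :
    ∃ p ∈ P, 2 * (S.filter fun x => bad x p).card ≤ S.card := by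
  refine Finset.exists_le_of_sum_le hP ?_
  calc ∑ p ∈ P, 2 * (S.filter fun x => bad x p).card
      = ∑ x ∈ S, 2 * (P.filter fun p => bad x p).card := by
        rw [← Finset.mul_sum, ← Finset.mul_sum]
        exact congrArg _ (Finset.sum_card_bipartiteAbove_eq_sum_card_bipartiteBelow bad).symm
    _ ≤ ∑ _x ∈ S, P.card := Finset.sum_le_sum h
    _ = ∑ _p ∈ P, S.card := by simp [mul_comm]

/-- If every point of `S` is bad for at most half of the elements of `P` and `|S| < 2 ^ k`, then
some `k` elements of `P` suffice to make every point of `S` good for one of them. -/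
theorem exists_fin_forall_exists_not_bad {α β : Type*} {P : Finset β} (hP : P.Nonempty)
    (bad : α → β → Prop) [∀ x p, Decidable (bad x p)] (k : ℕ) (S : Finset α)
    (hS : S.card < 2 ^ k) (h : ∀ x ∈ S, 2 * (P.filter fun p => bad x p).card ≤ P.card) :
    ∃ p : Fin k → β, (∀ i, p i ∈ P) ∧ ∀ x ∈ S, ∃ i, ¬ bad x (p i) := by
  induction k generalizing S with
  | zero =>
    obtain rfl : S = ∅ := by simpa using hS
    exact ⟨Fin.elim0, fun i => i.elim0, by simp⟩
  | succ k ih =>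
    obtain ⟨q, hqP, hq⟩ := exists_two_mul_card_filter_le hP S bad h
    obtain ⟨p, hpP, hp⟩ := ih (S.filter fun x => bad x q) (by rw [pow_succ] at hS; omega)
      fun x hx => h x (Finset.mem_of_mem_filter x hx)
    refine ⟨Fin.cons q p, Fin.cases hqP hpP, fun x hx => ?_⟩
    by_cases hb : bad x q
    · obtain ⟨i, hi⟩ := hp x (Finset.mem_filter.2 ⟨hx, hb⟩)
      exact ⟨i.succ, by simpa using hi⟩
    · exact ⟨0, by simpa using hb⟩

/-- Chebyshev's lower bound for the number of primes, with base-two logarithms rounded up. -/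
theorem le_primeCounting_two_mul_mul {m a : ℕ} (hm : 3 ≤ m) (ha : 2 * m ≤ 2 ^ a) :
    m ≤ Nat.primeCounting (2 * m) * a := by
  have hpow : 2 * m + 1 ≤ 2 ^ m := by
    induction m, hm using Nat.le_induction with
    | base => norm_num
    | succ m hm ih => have := ih (by omega); rw [pow_succ]; omega
  have hlog2 : 0 < Real.log 2 := Real.log_pos one_lt_two
  have hsucc : Real.log ((2 * m : ℕ) + 1) ≤ m * Real.log 2 := by
    rw [← Real.log_pow]
    exact Real.log_le_log (by positivity) (mod_cast hpow)
  have hlog : Real.log (2 * m : ℕ) ≤ a * Real.log 2 := by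
    rw [← Real.log_pow]
    exact Real.log_le_log (mod_cast (by omega)) (mod_cast ha)
  have hpsi := (Chebyshev.psi_ge (2 * m)).trans (Chebyshev.psi_le_primeCounting_mul_log (2 * m))
  have hpi := mul_le_mul_of_nonneg_left hlog (Nat.cast_nonneg (α := ℝ) (Nat.primeCounting (2 * m)))
  have hmul : (m : ℝ) * Real.log 2 ≤ (Nat.primeCounting (2 * m) * a) * Real.log 2 := by
    push_cast at *
    linarith
  exact_mod_cast le_of_mul_le_mul_right hmul hlog2

/-- There are at least `2 N l` primes up to `64 N l²`, provided `l` is at least about `log₂ N`. -/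
theorem two_mul_mul_le_primeCounting {N l : ℕ} (hN : 1 ≤ N) (hl : 1 ≤ l) (hNl : N ≤ 2 ^ (l + 1)) :
    2 * N * l ≤ Nat.primeCounting (64 * N * l ^ 2) := by
  have hNl2 : 1 ≤ N * l ^ 2 := Nat.mul_pos hN (by positivity)
  have hbound : 2 * (32 * (N * l ^ 2)) ≤ 2 ^ (10 * l) :=
    calc 2 * (32 * (N * l ^ 2)) = 2 ^ 6 * (N * l ^ 2) := by ring
      _ ≤ 2 ^ 6 * (2 ^ (l + 1) * (2 ^ l) ^ 2) := by gcongr; exact Nat.lt_two_pow_self.le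
      _ = 2 ^ (6 + (l + 1) + l * 2) := by ring
      _ ≤ 2 ^ (10 * l) := Nat.pow_le_pow_right two_pos (by omega)
  have h := le_primeCounting_two_mul_mul (by omega) hbound
  rw [show 2 * (32 * (N * l ^ 2)) = 64 * N * l ^ 2 by ring] at h
  refine le_of_mul_le_mul_right (le_trans ?_ h) (by omega : 0 < 10 * l)
  nlinarith

/-- The randomized hash-family construction in the FFT Lemma: there is an absolute
constant `c > 0` so that for every `U ≥ 2` and every `T ⊆ [U]` with `|T| = N ≥ 2`,
there exist `k ≤ log₂ N + 1` primes `p₁, …, p_k`, each at most `c·N·(log₂ U)²`,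
such that every `x ∈ T` is collision-free modulo some `pᵢ` within `T`. -/
theorem stmt_10 : ∃ c : ℝ, 0 < c ∧
    ∀ (U N : ℕ) (T : Finset ℕ),
      2 ≤ U → (∀ x ∈ T, x < U) → T.card = N → 2 ≤ N →
      ∃ (k : ℕ) (p : Fin k → ℕ),
        (k : ℝ) ≤ Real.logb 2 N + 1 ∧
        (∀ i, (p i).Prime ∧ (p i : ℝ) ≤ c * N * (Real.logb 2 U) ^ 2) ∧
        ∀ x ∈ T, ∃ i, ∀ y ∈ T, y ≠ x → ¬ (y % p i = x % p i) := by
  refine ⟨64, by norm_num, fun U N T hU hT hcard hN => ?_⟩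
  set l := Nat.log 2 U
  have hl1 : 1 ≤ l := Nat.log_pos one_lt_two hU
  have hNU : N ≤ U := by
    rw [← hcard, ← Finset.card_range U]
    exact Finset.card_le_card fun x hx => Finset.mem_range.2 (hT x hx)
  set P := Nat.primesLE (64 * N * l ^ 2) with hPdef
  have hP : ∀ p ∈ P, p.Prime := fun p hp => Nat.prime_of_mem_primesLE hp
  have hPcard : 2 * (N * l) ≤ P.card := by
    rw [hPdef, Nat.primesLE_card_eq_primeCounting, ← mul_assoc]
    exact two_mul_mul_le_primeCounting (by omega) hl1
      (hNU.trans (Nat.lt_pow_succ_log_self one_lt_two U).le)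
  have hPne : P.Nonempty := Finset.card_pos.1 <| lt_of_lt_of_le (by positivity) hPcard
  classical
  obtain ⟨p, hpP, hp⟩ := exists_fin_forall_exists_not_bad hPne
    (fun x p => ∃ y ∈ T, y ≠ x ∧ y % p = x % p) (Nat.log 2 N + 1) T
    (hcard ▸ Nat.lt_pow_succ_log_self one_lt_two N) fun x hx => by
      refine le_trans (Nat.mul_le_mul_left 2 ?_) hPcard
      have hsub : (P.filter fun p => ∃ y ∈ T, y ≠ x ∧ y % p = x % p) ⊆
          (T.erase x).biUnion fun y => P.filter fun p => y % p = x % p := by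
        intro p
        simp only [Finset.mem_filter, Finset.mem_biUnion, Finset.mem_erase]
        rintro ⟨hp, y, hy, hyx, h⟩
        exact ⟨y, ⟨hyx, hy⟩, hp, h⟩
      calc _ ≤ _ := Finset.card_le_card hsub
        _ ≤ (T.erase x).card * l := Finset.card_biUnion_le_card_mul _ _ _ fun y hy =>
            card_filter_mod_eq_le_log hP (hT x hx) (hT y (Finset.mem_of_mem_erase hy))
              (Finset.ne_of_mem_erase hy)
        _ ≤ N * l := Nat.mul_le_mul_right l (hcard ▸ Finset.card_erase_le)
  refine ⟨Nat.log 2 N + 1, p, ?_, fun i => ⟨hP _ (hpP i), ?_⟩, fun x hx => ?_⟩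
  · push_cast
    gcongr
    exact_mod_cast Real.natLog_le_logb N 2
  · calc (p i : ℝ) ≤ 64 * N * (l : ℝ) ^ 2 := mod_cast Nat.le_of_mem_primesLE (hpP i)
      _ ≤ 64 * N * Real.logb 2 U ^ 2 := by
        gcongr
        exact_mod_cast Real.natLog_le_logb U 2
  · obtain ⟨i, hi⟩ := hp x hx
    exact ⟨i, fun y hy hyx h => hi ⟨y, hy, hyx, h⟩⟩
end
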